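/- arXiv:2203.14627 — 4 statements merged into one kernel-verified Lean document; each statement's English description precedes it below -/
import Mathlib

section
/- Let g : ℝ^n → ℝ^n be a κ-contraction with fixed point x*, and suppose g has an L-Lipschitz derivative on B(x*, ρ). Fix an integer m ≥ 1 and a real M ≥ 1. Then there exists a constant C > 0, depending only on κ, L, m and M, such that the following holds: for all points x_0, …, x_m ∈ B(x*, ρ), all coefficients α_0, …, α_m ∈ ℝ with Σ_{i=0}^m α_i = 1 and Σ_{i=0}^m |α_i| ≤ M for which the affine combinations x^α := Σ_{i=0}^m α_i x_i and x̃^α := Σ_{i=0}^m α_i g(x_i) both lie in B(x*, ρ), and every damping factor β ∈ [0,1], the damped Anderson-acceleration step x′ := (1 − β) x^α + β x̃^α satisfies ‖f(x′)‖ ≤ ((1 − β) + κ β) · ‖Σ_{i=0}^m α_i f(x_i)‖ + C · Σ_{i=0}^m ‖f(x_i)‖². -/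
/-- First-order Taylor estimate at `c` for a map whose derivative is Lipschitz around `c`. -/
theorem norm_taylor_remainder_le_of_lipschitz_fderiv
    {E F : Type*} [NormedAddCommGroup E] [NormedSpace ℝ E] [NormedAddCommGroup F]
    [NormedSpace ℝ F] {g : E → F} {g' : E → E →L[ℝ] F} {c y : E} {ρ L : ℝ} (hL : 0 ≤ L)
    (hg : ∀ x ∈ Metric.closedBall c ρ, HasFDerivAt g (g' x) x)
    (hlip : ∀ x ∈ Metric.closedBall c ρ, ‖g' x - g' c‖ ≤ L * ‖x - c‖)
    (hy : y ∈ Metric.closedBall c ρ) :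
    ‖g y - g c - g' c (y - c)‖ ≤ L * ‖y - c‖ ^ 2 := by
  have hsub : Metric.closedBall c ‖y - c‖ ⊆ Metric.closedBall c ρ :=
    Metric.closedBall_subset_closedBall (mem_closedBall_iff_norm.1 hy)
  calc ‖g y - g c - g' c (y - c)‖ ≤ L * ‖y - c‖ * ‖y - c‖ := by
        refine (convex_closedBall c ‖y - c‖).norm_image_sub_le_of_norm_hasFDerivWithin_le'
          (fun x hx => (hg x (hsub hx)).hasFDerivWithinAt) (fun x hx => ?_)
          (Metric.mem_closedBall_self (norm_nonneg _)) (mem_closedBall_iff_norm.2 le_rfl)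
        exact (hlip x (hsub hx)).trans
          (mul_le_mul_of_nonneg_left (mem_closedBall_iff_norm.1 hx) hL)
    _ = L * ‖y - c‖ ^ 2 := by ring

/-- The distance to a fixed point of a contraction is controlled by the residual. -/
theorem norm_sub_fixedPoint_le_of_contraction {E : Type*} [NormedAddCommGroup E] {g : E → E}
    {c : E} {κ : ℝ} (hκ : κ < 1) (hc : g c = c) (hg : ∀ x y, ‖g y - g x‖ ≤ κ * ‖y - x‖)
    (x : E) : ‖x - c‖ ≤ ‖g x - x‖ / (1 - κ) := by
  rw [le_div_iff₀ (sub_pos.2 hκ)]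
  have h := hg c x
  rw [hc] at h
  have htri : ‖x - c‖ ≤ ‖g x - x‖ + ‖g x - c‖ := by
    rw [norm_sub_rev (g x) x]
    exact norm_sub_le_norm_sub_add_norm_sub x (g x) c
  linarith

theorem norm_sum_smul_le_mul_sum {ι E : Type*} [Fintype ι] [NormedAddCommGroup E]
    [NormedSpace ℝ E] {α : ι → ℝ} {M : ℝ} (hα : ∑ i, |α i| ≤ M) {v : ι → E} {b : ι → ℝ}
    (hv : ∀ i, ‖v i‖ ≤ b i) : ‖∑ i, α i • v i‖ ≤ M * ∑ i, b i := by
  have hb : ∀ i, 0 ≤ b i := fun i => (norm_nonneg _).trans (hv i)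
  calc ‖∑ i, α i • v i‖ ≤ ∑ i, |α i| * b i := norm_sum_le_of_le _ fun i _ => by
        rw [norm_smul, Real.norm_eq_abs]
        exact mul_le_mul_of_nonneg_left (hv i) (abs_nonneg _)
    _ ≤ ∑ i, M * b i := Finset.sum_le_sum fun i hi => mul_le_mul_of_nonneg_right
        ((Finset.single_le_sum (fun j _ => abs_nonneg (α j)) hi).trans hα) (hb i)
    _ = M * ∑ i, b i := (Finset.mul_sum ..).symm

theorem norm_sum_smul_sq_le {ι E : Type*} [Fintype ι] [NormedAddCommGroup E]
    [NormedSpace ℝ E] {α : ι → ℝ} {M : ℝ} (hα : ∑ i, |α i| ≤ M) (v : ι → E) :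
    ‖∑ i, α i • v i‖ ^ 2 ≤ M ^ 2 * ∑ i, ‖v i‖ ^ 2 := by
  have hα0 : 0 ≤ ∑ i, |α i| := Finset.sum_nonneg fun i _ => abs_nonneg _
  calc ‖∑ i, α i • v i‖ ^ 2 ≤ (∑ i, |α i| * ‖v i‖) ^ 2 := by
        gcongr
        exact norm_sum_le_of_le _ fun i _ => by rw [norm_smul, Real.norm_eq_abs]
    _ ≤ (∑ i, |α i| ^ 2) * ∑ i, ‖v i‖ ^ 2 := Finset.sum_mul_sq_le_sq_mul_sq ..
    _ ≤ M ^ 2 * ∑ i, ‖v i‖ ^ 2 := by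
        gcongr
        exact (Finset.sum_sq_le_sq_sum_of_nonneg fun i _ => abs_nonneg (α i)).trans
          (pow_le_pow_left₀ hα0 hα 2)

/-- A map with Lipschitz derivative commutes with affine combinations up to a quadratic error in
the distances to the centre. -/
theorem norm_image_affine_sub_le_of_lipschitz_fderiv
    {ι E F : Type*} [Fintype ι] [NormedAddCommGroup E] [NormedSpace ℝ E] [NormedAddCommGroup F]
    [NormedSpace ℝ F] {g : E → F} {g' : E → E →L[ℝ] F} {c : E} {ρ L M : ℝ} (hL : 0 ≤ L)
    (hg : ∀ x ∈ Metric.closedBall c ρ, HasFDerivAt g (g' x) x)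
    (hlip : ∀ x ∈ Metric.closedBall c ρ, ‖g' x - g' c‖ ≤ L * ‖x - c‖)
    {x : ι → E} {α : ι → ℝ} (hx : ∀ i, x i ∈ Metric.closedBall c ρ) (hα : ∑ i, α i = 1)
    (hM : ∑ i, |α i| ≤ M) (ha : ∑ i, α i • x i ∈ Metric.closedBall c ρ) :
    ‖g (∑ i, α i • x i) - ∑ i, α i • g (x i)‖ ≤ L * (M ^ 2 + M) * ∑ i, ‖x i - c‖ ^ 2 := by
  have hac : ∑ i, α i • x i - c = ∑ i, α i • (x i - c) := by
    simp only [smul_sub, Finset.sum_sub_distrib, ← Finset.sum_smul, hα, one_smul]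
  have hsplit : g (∑ i, α i • x i) - ∑ i, α i • g (x i) =
      (g (∑ i, α i • x i) - g c - g' c (∑ i, α i • x i - c)) -
        ∑ i, α i • (g (x i) - g c - g' c (x i - c)) := by
    rw [hac]
    simp only [smul_sub, Finset.sum_sub_distrib, ← Finset.sum_smul, hα, one_smul, map_sub,
      map_sum, map_smul]
    abel
  have h₁ := norm_taylor_remainder_le_of_lipschitz_fderiv hL hg hlip ha
  have h₂ := norm_sum_smul_le_mul_sum hM fun i =>
    norm_taylor_remainder_le_of_lipschitz_fderiv hL hg hlip (hx i)
  have h₃ := norm_sum_smul_sq_le hM fun i => x i - c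
  rw [← hac] at h₃
  rw [← Finset.mul_sum] at h₂
  rw [hsplit]
  refine (norm_sub_le _ _).trans ?_
  linarith [mul_le_mul_of_nonneg_left h₃ hL]

/-- One damped Anderson-acceleration step residual bound.
For a κ-contraction `g` with fixed point `xstar` whose derivative is `L`-Lipschitz on the
closed ball `B(xstar, ρ)`, there is a constant `C > 0` depending only on `κ, L, m, M` such
that for iterates `x 0, …, x m` in the ball, coefficients `α` summing to `1` with
`∑ |α i| ≤ M`, whose affine combinations `x^α = ∑ α i • x i` and `x̃^α = ∑ α i • g (x i)`
lie in the ball, and any damping factor `β ∈ [0,1]`, the damped step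
`x' = (1 - β) • x^α + β • x̃^α` satisfies
`‖f x'‖ ≤ ((1-β) + κ β) ‖∑ α i • f (x i)‖ + C ∑ ‖f (x i)‖²`, where `f x = g x - x`. -/
theorem anderson_damped_step_residual_bound
    (κ L M : ℝ) (m : ℕ) (hm : 1 ≤ m)
    (hκ0 : 0 < κ) (hκ1 : κ < 1) (hL : 0 ≤ L) (hM : 1 ≤ M) :
    ∃ C > 0, ∀ (n : ℕ)
      (g : EuclideanSpace ℝ (Fin n) → EuclideanSpace ℝ (Fin n))
      (g' : EuclideanSpace ℝ (Fin n) →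
        (EuclideanSpace ℝ (Fin n) →L[ℝ] EuclideanSpace ℝ (Fin n)))
      (xstar : EuclideanSpace ℝ (Fin n)) (ρ : ℝ),
      g xstar = xstar →
      (∀ x y, ‖g y - g x‖ ≤ κ * ‖y - x‖) →
      (∀ x ∈ Metric.closedBall xstar ρ, HasFDerivAt g (g' x) x) →
      (∀ x ∈ Metric.closedBall xstar ρ, ∀ y ∈ Metric.closedBall xstar ρ,
        ‖g' x - g' y‖ ≤ L * ‖x - y‖) →
      ∀ (x : Fin (m + 1) → EuclideanSpace ℝ (Fin n)) (α : Fin (m + 1) → ℝ),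
        (∀ i, x i ∈ Metric.closedBall xstar ρ) →
        (∑ i, α i) = 1 →
        (∑ i, |α i|) ≤ M →
        (∑ i, α i • x i) ∈ Metric.closedBall xstar ρ →
        (∑ i, α i • g (x i)) ∈ Metric.closedBall xstar ρ →
        ∀ β : ℝ, 0 ≤ β → β ≤ 1 →
          ‖g ((1 - β) • (∑ i, α i • x i) + β • (∑ i, α i • g (x i))) -
              ((1 - β) • (∑ i, α i • x i) + β • (∑ i, α i • g (x i)))‖ ≤
            ((1 - β) + κ * β) * ‖∑ i, α i • (g (x i) - x i)‖ +
              C * ∑ i, ‖g (x i) - x i‖ ^ 2 := by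
  have hκ : 0 < 1 - κ := sub_pos.2 hκ1
  refine ⟨L * (M ^ 2 + M) / (1 - κ) ^ 2 + 1, by positivity, ?_⟩
  intro n g g' xstar ρ hfix hcontr hderiv hlip x α hx hα hαM ha _ β hβ0 hβ1
  have hcenter : xstar ∈ Metric.closedBall xstar ρ :=
    Metric.mem_closedBall_self (dist_nonneg.trans (Metric.mem_closedBall.1 ha))
  have haffine := norm_image_affine_sub_le_of_lipschitz_fderiv hL hderiv
    (fun y hy => hlip y hy xstar hcenter) hx hα hαM ha
  have hdist : ∑ i, ‖x i - xstar‖ ^ 2 ≤ (∑ i, ‖g (x i) - x i‖ ^ 2) / (1 - κ) ^ 2 := by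
    rw [Finset.sum_div]
    refine Finset.sum_le_sum fun i _ => ?_
    rw [← div_pow]
    exact pow_le_pow_left₀ (norm_nonneg _)
      (norm_sub_fixedPoint_le_of_contraction hκ1 hfix hcontr (x i)) 2
  have hquad : L * (M ^ 2 + M) * ∑ i, ‖x i - xstar‖ ^ 2 ≤
      (L * (M ^ 2 + M) / (1 - κ) ^ 2 + 1) * ∑ i, ‖g (x i) - x i‖ ^ 2 := by
    have hsum : 0 ≤ ∑ i, ‖g (x i) - x i‖ ^ 2 := by positivity
    calc _ ≤ L * (M ^ 2 + M) * ((∑ i, ‖g (x i) - x i‖ ^ 2) / (1 - κ) ^ 2) := by gcongr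
      _ = L * (M ^ 2 + M) / (1 - κ) ^ 2 * ∑ i, ‖g (x i) - x i‖ ^ 2 := by ring
      _ ≤ _ := by linarith
  have hres : ∑ i, α i • (g (x i) - x i) = ∑ i, α i • g (x i) - ∑ i, α i • x i := by
    simp only [smul_sub, Finset.sum_sub_distrib]
  rw [hres]
  set a := ∑ i, α i • x i
  set b := ∑ i, α i • g (x i)
  have hstep : (1 - β) • a + β • b - a = β • (b - a) := by module
  have hmove : ‖g ((1 - β) • a + β • b) - g a‖ ≤ κ * (β * ‖b - a‖) := by
    have h := hcontr a ((1 - β) • a + β • b)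
    rwa [hstep, norm_smul, Real.norm_of_nonneg hβ0] at h
  have hdamp : ‖(1 - β) • (b - a)‖ = (1 - β) * ‖b - a‖ := by
    rw [norm_smul, Real.norm_of_nonneg (sub_nonneg.2 hβ1)]
  have hsplit : g ((1 - β) • a + β • b) - ((1 - β) • a + β • b) =
      (g ((1 - β) • a + β • b) - g a) + (g a - b) + (1 - β) • (b - a) := by module
  rw [hsplit]
  refine norm_add₃_le.trans ?_
  rw [hdamp]
  linarith
end

section
/- (Convergence rate of the composite method AA(m, AA(1)) with one inner iteration.) Let g : ℝ^n → ℝ^n be a κ-contraction with fixed point x*, and suppose g has an L-Lipschitz derivative on B(x*, ρ). Fix an integer m ≥ 1 and a real M ≥ 1. Then there exists C > 0 depending only on κ, L, m and M such that the following holds. Suppose x_{k−m}, …, x_k ∈ B(x*, ρ) with f(x_k) ≠ 0; suppose α = (α_0, …, α_m) solves min ‖Σ_{i=0}^m α_i f(x_{k−m+i})‖ subject to Σ_{i=0}^m α_i = 1, with Σ_{i=0}^m |α_i| ≤ M and Σ_{i=0}^m α_i x_{k−m+i} ∈ B(x*, ρ); let x̄_0 := Σ_{i=0}^m α_i g(x_{k−m+i})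 (the undamped outer AA(m) step) and x̄_1 := g(x̄_0), and assume x̄_0, x̄_1 ∈ B(x*, ρ), f(x̄_1) ≠ 0, and ᾱ_0 x̄_0 + ᾱ_1 x̄_1 ∈ B(x*, ρ), where (ᾱ_0, ᾱ_1) solves min ‖ᾱ_0 f(x̄_0) + ᾱ_1 f(x̄_1)‖ subject to ᾱ_0 + ᾱ_1 = 1, with |ᾱ_0| + |ᾱ_1| ≤ M; set x_{k+1} := ᾱ_0 g(x̄_0) + ᾱ_1 g(x̄_1) (the inner AA(1) step). Define θ_{k+1} := ‖Σ_{i=0}^m α_i f(x_{k−m+i})‖ / ‖f(x_k)‖ and θ̄_1 := ‖ᾱ_0 f(x̄_0) + ᾱ_1 f(x̄_1)‖ / ‖f(x̄_1)‖. Then ‖f(x_{k+1})‖ ≤ θ̄_1 θ_{k+1} κ² ‖f(x_k)‖ + C · ( Σ_{i=0}^m ‖f(x_{k−m+i})‖² + ‖f(x̄_0)‖² + ‖f(x̄_1)‖² ). -/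
/-- The distance to a fixed point of a contraction is controlled by the residual. -/
lemma norm_sub_fixedPoint_le {E : Type*} [NormedAddCommGroup E] {g : E → E} {c : E} {κ : ℝ}
    (hκ1 : κ < 1) (hc : g c = c) (hcontr : ∀ x y, ‖g y - g x‖ ≤ κ * ‖y - x‖) (y : E) :
    ‖y - c‖ ≤ ‖g y - y‖ / (1 - κ) := by
  rw [le_div_iff₀ (by linarith)]
  have h1 := hcontr c y
  rw [hc] at h1
  have h2 : ‖y - c‖ ≤ ‖g y - c‖ + ‖g y - y‖ := by
    have := norm_sub_le (g y - c) (g y - y)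
    rwa [sub_sub_sub_cancel_left] at this
  linarith

section AffineCombination

variable {E : Type*} [NormedAddCommGroup E] [NormedSpace ℝ E]

/-- First-order Taylor estimate for a map whose derivative is Lipschitz on a ball,
expanded at the centre of the ball. -/
lemma norm_taylor_center_le {g : E → E} {g' : E → E →L[ℝ] E} {c : E} {ρ L : ℝ}
    (hL : 0 ≤ L)
    (hg : ∀ x ∈ Metric.closedBall c ρ, HasFDerivAt g (g' x) x)
    (hlip : ∀ x ∈ Metric.closedBall c ρ, ∀ y ∈ Metric.closedBall c ρ,
      ‖g' x - g' y‖ ≤ L * ‖x - y‖)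
    {y : E} (hy : y ∈ Metric.closedBall c ρ) :
    ‖g y - g c - g' c (y - c)‖ ≤ L * ‖y - c‖ ^ 2 := by
  have hsub : Metric.closedBall c ‖y - c‖ ⊆ Metric.closedBall c ρ :=
    Metric.closedBall_subset_closedBall (by simpa [dist_eq_norm] using hy)
  have hc : c ∈ Metric.closedBall c ‖y - c‖ := Metric.mem_closedBall_self (norm_nonneg _)
  have h := (convex_closedBall c ‖y - c‖).norm_image_sub_le_of_norm_hasFDerivWithin_le'
    (f := g) (f' := g') (φ := g' c) (C := L * ‖y - c‖) (x := c) (y := y)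
    (fun z hz => (hg z (hsub hz)).hasFDerivWithinAt)
    (fun z hz => (hlip z (hsub hz) c (hsub hc)).trans
      (mul_le_mul_of_nonneg_left (by simpa [dist_eq_norm] using hz) hL))
    hc (by simp [dist_eq_norm])
  calc _ ≤ L * ‖y - c‖ * ‖y - c‖ := h
    _ = L * ‖y - c‖ ^ 2 := by ring

variable {ι : Type*} [Fintype ι]

/-- A map with Lipschitz derivative commutes with affine combinations up to a quadratic error. -/
lemma norm_affineCombination_sub_le {g : E → E} {g' : E → E →L[ℝ] E} {c : E} {ρ L M : ℝ}
    (hL : 0 ≤ L) (hc : g c = c)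
    (hg : ∀ x ∈ Metric.closedBall c ρ, HasFDerivAt g (g' x) x)
    (hlip : ∀ x ∈ Metric.closedBall c ρ, ∀ y ∈ Metric.closedBall c ρ,
      ‖g' x - g' y‖ ≤ L * ‖x - y‖)
    {x : ι → E} {α : ι → ℝ} (hx : ∀ i, x i ∈ Metric.closedBall c ρ)
    (hα : ∑ i, α i = 1) (hαM : ∑ i, |α i| ≤ M)
    (hv : ∑ i, α i • x i ∈ Metric.closedBall c ρ) :
    ‖g (∑ i, α i • x i) - ∑ i, α i • g (x i)‖ ≤
      L * (M + M ^ 2) * ∑ i, ‖x i - c‖ ^ 2 := by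
  have hM : 0 ≤ M := (Finset.sum_nonneg fun i _ => abs_nonneg (α i)).trans hαM
  have haffine (y : ι → E) : (∑ i, α i • y i) - c = ∑ i, α i • (y i - c) := by
    simp only [smul_sub, Finset.sum_sub_distrib, ← Finset.sum_smul, hα, one_smul]
  set S := ∑ i, |α i| * ‖x i - c‖ ^ 2 with hS
  have hSM : S ≤ M * ∑ i, ‖x i - c‖ ^ 2 := by
    rw [hS, Finset.mul_sum]
    refine Finset.sum_le_sum fun i _ => mul_le_mul_of_nonneg_right ?_ (sq_nonneg _)
    exact (Finset.single_le_sum (f := fun i => |α i|) (fun j _ => abs_nonneg _)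
      (Finset.mem_univ i)).trans hαM
  have hS0 : 0 ≤ S := Finset.sum_nonneg fun i _ => by positivity
  have hvc : ‖(∑ i, α i • x i) - c‖ ^ 2 ≤ M * S := by
    have h1 : ‖(∑ i, α i • x i) - c‖ ≤ ∑ i, |α i| * ‖x i - c‖ := by
      rw [haffine]
      refine (norm_sum_le _ _).trans (Finset.sum_le_sum fun i _ => ?_)
      rw [norm_smul, Real.norm_eq_abs]
    have h2 : (∑ i, |α i| * ‖x i - c‖) ^ 2 ≤ (∑ i, |α i|) * S :=
      Finset.sum_sq_le_sum_mul_sum_of_sq_le_mul _ (fun i _ => abs_nonneg _)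
        (fun i _ => by positivity) (fun i _ => le_of_eq (by ring))
    calc _ ≤ (∑ i, |α i| * ‖x i - c‖) ^ 2 := by gcongr
      _ ≤ _ := h2
      _ ≤ M * S := by gcongr
  have hsplit : g (∑ i, α i • x i) - ∑ i, α i • g (x i) =
      (g (∑ i, α i • x i) - g c - g' c ((∑ i, α i • x i) - c)) -
        ∑ i, α i • (g (x i) - g c - g' c (x i - c)) := by
    have h1 := haffine fun i => g (x i)
    have h2 : g' c ((∑ i, α i • x i) - c) = ∑ i, α i • g' c (x i - c) := by
      rw [haffine, map_sum]
      simp only [map_smul]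
    rw [h2, hc]
    simp only [smul_sub (_ : ℝ) (_ - c) (g' c _), Finset.sum_sub_distrib, ← h1]
    abel
  have hrem : ‖∑ i, α i • (g (x i) - g c - g' c (x i - c))‖ ≤ L * S := by
    rw [hS, Finset.mul_sum]
    refine (norm_sum_le _ _).trans (Finset.sum_le_sum fun i _ => ?_)
    rw [norm_smul, Real.norm_eq_abs, mul_left_comm]
    gcongr
    exact norm_taylor_center_le hL hg hlip (hx i)
  rw [hsplit]
  calc _ ≤ L * ‖(∑ i, α i • x i) - c‖ ^ 2 + L * S :=
        (norm_sub_le _ _).trans (add_le_add (norm_taylor_center_le hL hg hlip hv) hrem)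
    _ ≤ L * (M * S) + L * S := by gcongr
    _ = L * (1 + M) * S := by ring
    _ ≤ L * (1 + M) * (M * ∑ i, ‖x i - c‖ ^ 2) := by gcongr
    _ = _ := by ring

/-- Residual bound for one undamped Anderson acceleration step. -/
lemma norm_residual_anderson_step_le {g : E → E} {g' : E → E →L[ℝ] E} {c : E} {κ ρ L M : ℝ}
    (hκ1 : κ < 1) (hL : 0 ≤ L) (hc : g c = c)
    (hcontr : ∀ x y, ‖g y - g x‖ ≤ κ * ‖y - x‖)
    (hg : ∀ x ∈ Metric.closedBall c ρ, HasFDerivAt g (g' x) x)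
    (hlip : ∀ x ∈ Metric.closedBall c ρ, ∀ y ∈ Metric.closedBall c ρ,
      ‖g' x - g' y‖ ≤ L * ‖x - y‖)
    {x : ι → E} {α : ι → ℝ} (hx : ∀ i, x i ∈ Metric.closedBall c ρ)
    (hα : ∑ i, α i = 1) (hαM : ∑ i, |α i| ≤ M)
    (hv : ∑ i, α i • x i ∈ Metric.closedBall c ρ) :
    ‖g (∑ i, α i • g (x i)) - ∑ i, α i • g (x i)‖ ≤
      κ * ‖∑ i, α i • (g (x i) - x i)‖ +
        L * (M + M ^ 2) / (1 - κ) ^ 2 * ∑ i, ‖g (x i) - x i‖ ^ 2 := by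
  have hM : 0 ≤ M := (Finset.sum_nonneg fun i _ => abs_nonneg (α i)).trans hαM
  have h1 := hcontr (∑ i, α i • x i) (∑ i, α i • g (x i))
  rw [← Finset.sum_sub_distrib] at h1
  simp only [← smul_sub] at h1
  have h2 := norm_affineCombination_sub_le hL hc hg hlip hx hα hαM hv
  have h3 : L * (M + M ^ 2) * ∑ i, ‖x i - c‖ ^ 2 ≤
      L * (M + M ^ 2) / (1 - κ) ^ 2 * ∑ i, ‖g (x i) - x i‖ ^ 2 := by
    rw [div_mul_eq_mul_div, mul_div_assoc, Finset.sum_div]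
    simp only [← div_pow]
    gcongr
    exact norm_sub_fixedPoint_le hκ1 hc hcontr _
  have h4 := norm_sub_le_norm_sub_add_norm_sub (g (∑ i, α i • g (x i)))
    (g (∑ i, α i • x i)) (∑ i, α i • g (x i))
  linarith

end AffineCombination

/-- Chaining the residual bounds of an outer step (minimal norm `W`, residual `p` afterwards),
a Picard step (residual `q` afterwards) and an inner step (minimal norm `w`, residual `r`
afterwards). -/
lemma two_step_rate_le {κ K w W S p q b r : ℝ} (hκ0 : 0 ≤ κ) (hκ1 : κ ≤ 1) (hK : 0 ≤ K)
    (hb : 0 < b) (hq : 0 < q) (hw : 0 ≤ w) (hW : 0 ≤ W) (hS : 0 ≤ S) (hgain : w ≤ q)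
    (houter : p ≤ κ * W + K * S) (hpicard : q ≤ κ * p)
    (hinner : r ≤ κ * w + K * (p ^ 2 + q ^ 2)) :
    r ≤ w / q * (W / b) * κ ^ 2 * b + (K + 1) * (S + p ^ 2 + q ^ 2) := by
  set θ := w / q with hθ
  have hθ0 : 0 ≤ θ := by positivity
  have hθ1 : θ ≤ 1 := (div_le_one hq).mpr hgain
  have hwθ : w = θ * q := by rw [hθ, div_mul_cancel₀ _ hq.ne']
  have hmain : θ * (W / b) * κ ^ 2 * b = θ * κ ^ 2 * W := by field_simp
  have hκw : κ * w ≤ θ * κ ^ 2 * W + K * S :=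
    calc κ * w = κ * (θ * q) := by rw [hwθ]
      _ ≤ κ * (θ * (κ * (κ * W + K * S))) := by
        gcongr
        exact hpicard.trans (by gcongr)
      _ = θ * κ ^ 2 * (κ * W) + κ ^ 2 * θ * (K * S) := by ring
      _ ≤ θ * κ ^ 2 * (1 * W) + 1 * (K * S) := by
        have : κ ^ 2 * θ ≤ 1 := mul_le_one₀ (pow_le_one₀ hκ0 hκ1) hθ0 hθ1
        gcongr
      _ = _ := by ring
  rw [hmain]
  linarith [sq_nonneg p, sq_nonneg q]

/-- Convergence rate of the composite method `AA(m, AA(1))` with one inner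
iteration.  For a κ-contraction `g` with fixed point `xstar` whose derivative is
`L`-Lipschitz on `B(xstar, ρ)`, there is `C > 0` depending only on `κ, L, m, M` such that:
if `x (k-m), …, x k ∈ B` with `f (x k) ≠ 0`, `α` solves the outer constrained
minimization with `∑ |α i| ≤ M` and `∑ α i • x (k-m+i) ∈ B`; the undamped outer step is
`x̄₀ = ∑ α i • g (x (k-m+i))` with `x̄₁ = g x̄₀`, both in `B`, `f x̄₁ ≠ 0`; `(ᾱ₀, ᾱ₁)`
solves the inner AA(1) minimization with `ᾱ₀ + ᾱ₁ = 1`, `|ᾱ₀| + |ᾱ₁| ≤ M`,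
`ᾱ₀ • x̄₀ + ᾱ₁ • x̄₁ ∈ B`; and `x_{k+1} = ᾱ₀ • g x̄₀ + ᾱ₁ • g x̄₁`; then
`‖f x_{k+1}‖ ≤ θ̄₁ θ_{k+1} κ² ‖f (x k)‖ + C (∑ ‖f (x (k-m+i))‖² + ‖f x̄₀‖² + ‖f x̄₁‖²)`
where `θ_{k+1}` and `θ̄₁` are the two gains and `f x = g x - x`. -/
theorem AA_m_AA1_convergence_rate
    (κ L M : ℝ) (m : ℕ) (hm : 1 ≤ m)
    (hκ0 : 0 < κ) (hκ1 : κ < 1) (hL : 0 ≤ L) (hM : 1 ≤ M) :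
    ∃ C > 0, ∀ (n : ℕ)
      (g : EuclideanSpace ℝ (Fin n) → EuclideanSpace ℝ (Fin n))
      (g' : EuclideanSpace ℝ (Fin n) →
        (EuclideanSpace ℝ (Fin n) →L[ℝ] EuclideanSpace ℝ (Fin n)))
      (xstar : EuclideanSpace ℝ (Fin n)) (ρ : ℝ),
      g xstar = xstar →
      (∀ x y, ‖g y - g x‖ ≤ κ * ‖y - x‖) →
      (∀ x ∈ Metric.closedBall xstar ρ, HasFDerivAt g (g' x) x) →
      (∀ x ∈ Metric.closedBall xstar ρ, ∀ y ∈ Metric.closedBall xstar ρ,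
        ‖g' x - g' y‖ ≤ L * ‖x - y‖) →
      ∀ (k : ℕ), m ≤ k →
      ∀ (x : ℕ → EuclideanSpace ℝ (Fin n)) (α : Fin (m + 1) → ℝ) (a₀ a₁ : ℝ)
        (xb0 xb1 xnext : EuclideanSpace ℝ (Fin n)),
        (∀ i : Fin (m + 1), x (k - m + (i : ℕ)) ∈ Metric.closedBall xstar ρ) →
        g (x k) - x k ≠ 0 →
        (∑ i, α i) = 1 →
        (∀ α' : Fin (m + 1) → ℝ, (∑ i, α' i) = 1 →
          ‖∑ i, α i • (g (x (k - m + (i : ℕ))) - x (k - m + (i : ℕ)))‖ ≤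
          ‖∑ i, α' i • (g (x (k - m + (i : ℕ))) - x (k - m + (i : ℕ)))‖) →
        (∑ i, |α i|) ≤ M →
        (∑ i, α i • x (k - m + (i : ℕ))) ∈ Metric.closedBall xstar ρ →
        xb0 = (∑ i, α i • g (x (k - m + (i : ℕ)))) →
        xb1 = g xb0 →
        xb0 ∈ Metric.closedBall xstar ρ →
        xb1 ∈ Metric.closedBall xstar ρ →
        g xb1 - xb1 ≠ 0 →
        a₀ + a₁ = 1 →
        (∀ b₀ b₁ : ℝ, b₀ + b₁ = 1 →
          ‖a₀ • (g xb0 - xb0) + a₁ • (g xb1 - xb1)‖ ≤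
          ‖b₀ • (g xb0 - xb0) + b₁ • (g xb1 - xb1)‖) →
        |a₀| + |a₁| ≤ M →
        a₀ • xb0 + a₁ • xb1 ∈ Metric.closedBall xstar ρ →
        xnext = a₀ • g xb0 + a₁ • g xb1 →
        ‖g xnext - xnext‖ ≤
          (‖a₀ • (g xb0 - xb0) + a₁ • (g xb1 - xb1)‖ / ‖g xb1 - xb1‖) *
            (‖∑ i, α i • (g (x (k - m + (i : ℕ))) - x (k - m + (i : ℕ)))‖ /
              ‖g (x k) - x k‖) * κ ^ 2 * ‖g (x k) - x k‖ +
          C * ((∑ i : Fin (m + 1),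
                  ‖g (x (k - m + (i : ℕ))) - x (k - m + (i : ℕ))‖ ^ 2) +
               ‖g xb0 - xb0‖ ^ 2 + ‖g xb1 - xb1‖ ^ 2) := by
  set K := L * (M + M ^ 2) / (1 - κ) ^ 2 with hK
  have hK0 : 0 ≤ K := by positivity
  refine ⟨K + 1, by positivity, ?_⟩
  intro n g g' xstar ρ hfix hcontr hg hlip k hmk x α a₀ a₁ xb0 xb1 xnext hx hfk hα _ hαM hv
    hxb0 hxb1 hb0 hb1 hf1 ha hmin haM hu hxnext
  have houter := norm_residual_anderson_step_le hκ1 hL hfix hcontr hg hlip hx hα hαM hv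
  rw [← hxb0, ← hK] at houter
  have hinner := norm_residual_anderson_step_le (x := ![xb0, xb1]) (α := ![a₀, a₁]) (M := M)
    hκ1 hL hfix hcontr hg hlip (by simp [Fin.forall_fin_two, hb0, hb1, -Metric.mem_closedBall])
    (by simpa using ha) (by simpa using haM) (by simpa using hu)
  simp only [Fin.sum_univ_two, Matrix.cons_val_zero, Matrix.cons_val_one] at hinner
  rw [← hxnext, ← hK] at hinner
  have hpicard : ‖g xb1 - xb1‖ ≤ κ * ‖g xb0 - xb0‖ := by
    simpa only [← hxb1] using hcontr xb0 xb1
  have hgain := hmin 0 1 (by norm_num)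
  rw [zero_smul, zero_add, one_smul] at hgain
  exact two_step_rate_le hκ0.le hκ1.le hK0 (norm_pos_iff.mpr hfk) (norm_pos_iff.mpr hf1)
    (norm_nonneg _) (norm_nonneg _) (Finset.sum_nonneg fun i _ => sq_nonneg _)
    hgain houter hpicard hinner
end

section
/- (Residual bound for one inner AA(1) step.) Let g : ℝ^n → ℝ^n be a κ-contraction with fixed point x*, and suppose g has an L-Lipschitz derivative on B(x*, ρ). Fix a real M ≥ 1. Then there exists C > 0 depending only on κ, L and M such that the following holds: for every x̄_0 ∈ B(x*, ρ) with x̄_1 := g(x̄_0) ∈ B(x*, ρ), and every pair ᾱ_0, ᾱ_1 ∈ ℝ with ᾱ_0 + ᾱ_1 = 1 and |ᾱ_0| + |ᾱ_1| ≤ M such that ᾱ_0 x̄_0 + ᾱ_1 x̄_1 ∈ B(x*, ρ), the point x̄_2 := ᾱ_0 g(x̄_0) + ᾱ_1 g(x̄_1) satisfies ‖f(x̄_2)‖ ≤ κ ‖ᾱ_0 f(x̄_0) + ᾱ_1 f(x̄_1)‖ + C (‖f(x̄_0)‖² + ‖f(x̄_1)‖²). -/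
/-- First-order Taylor estimate on a convex set for a map with Lipschitz derivative. -/
lemma Convex.norm_sub_sub_fderiv_le_of_lipschitz {E F : Type*}
    [NormedAddCommGroup E] [NormedSpace ℝ E] [NormedAddCommGroup F] [NormedSpace ℝ F]
    {s : Set E} (hs : Convex ℝ s) {g : E → F} {g' : E → E →L[ℝ] F} {L : ℝ} (hL : 0 ≤ L)
    (hg : ∀ x ∈ s, HasFDerivAt g (g' x) x)
    (hLip : ∀ x ∈ s, ∀ y ∈ s, ‖g' x - g' y‖ ≤ L * ‖x - y‖)
    {x z : E} (hx : x ∈ s) (hz : z ∈ s) :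
    ‖g x - g z - g' z (x - z)‖ ≤ L * ‖x - z‖ ^ 2 := by
  have hsub : segment ℝ z x ⊆ s := hs.segment_subset hz hx
  have hbound : ∀ y ∈ segment ℝ z x, ‖g' y - g' z‖ ≤ L * ‖x - z‖ := by
    intro y hy
    refine (hLip y (hsub hy) z hz).trans (mul_le_mul_of_nonneg_left ?_ hL)
    exact norm_sub_le_of_mem_segment hy
  calc ‖g x - g z - g' z (x - z)‖ ≤ L * ‖x - z‖ * ‖x - z‖ :=
        (convex_segment z x).norm_image_sub_le_of_norm_hasFDerivWithin_le'
          (fun y hy => (hg y (hsub hy)).hasFDerivWithinAt) hbound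
          (left_mem_segment ℝ z x) (right_mem_segment ℝ z x)
    _ = L * ‖x - z‖ ^ 2 := by ring

/-- A map with Lipschitz derivative commutes with two-point affine combinations
up to a quadratic error. -/
lemma Convex.norm_map_affine_combination_sub_le {E F : Type*}
    [NormedAddCommGroup E] [NormedSpace ℝ E] [NormedAddCommGroup F] [NormedSpace ℝ F]
    {s : Set E} (hs : Convex ℝ s) {g : E → F} {g' : E → E →L[ℝ] F} {L : ℝ} (hL : 0 ≤ L)
    (hg : ∀ x ∈ s, HasFDerivAt g (g' x) x)
    (hLip : ∀ x ∈ s, ∀ y ∈ s, ‖g' x - g' y‖ ≤ L * ‖x - y‖)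
    {x y : E} (hx : x ∈ s) (hy : y ∈ s) {a b : ℝ} (hab : a + b = 1)
    (hz : a • x + b • y ∈ s) :
    ‖g (a • x + b • y) - (a • g x + b • g y)‖ ≤
      L * (|a| * |b| * (|a| + |b|)) * ‖y - x‖ ^ 2 := by
  set z := a • x + b • y with hzdef
  obtain rfl : a = 1 - b := by linarith
  have hxz : x - z = (-b) • (y - x) := by rw [hzdef]; module
  have hyz : y - z = (1 - b) • (y - x) := by rw [hzdef]; module
  have hx' := hs.norm_sub_sub_fderiv_le_of_lipschitz hL hg hLip hx hz
  have hy' := hs.norm_sub_sub_fderiv_le_of_lipschitz hL hg hLip hy hz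
  have key : g z - ((1 - b) • g x + b • g y) =
      -((1 - b) • (g x - g z - g' z (x - z)) + b • (g y - g z - g' z (y - z))) := by
    rw [hxz, hyz, map_smul, map_smul]
    module
  rw [key, norm_neg]
  calc _ ≤ |1 - b| * ‖g x - g z - g' z (x - z)‖ + |b| * ‖g y - g z - g' z (y - z)‖ := by
        refine (norm_add_le _ _).trans_eq ?_
        rw [norm_smul, norm_smul, Real.norm_eq_abs, Real.norm_eq_abs]
    _ ≤ |1 - b| * (L * ‖x - z‖ ^ 2) + |b| * (L * ‖y - z‖ ^ 2) := by gcongr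
    _ = L * (|1 - b| * |b| * (|1 - b| + |b|)) * ‖y - x‖ ^ 2 := by
        rw [hxz, hyz, norm_smul, norm_smul, Real.norm_eq_abs, Real.norm_eq_abs, abs_neg]
        ring

/-- Residual bound for one inner AA(1) step.  For a κ-contraction `g` with
fixed point `xstar` whose derivative is `L`-Lipschitz on `B(xstar, ρ)`, there is `C > 0`
depending only on `κ, L, M` such that: for every `x̄₀ ∈ B` with `x̄₁ = g x̄₀ ∈ B`, and
coefficients `ᾱ₀ + ᾱ₁ = 1` with `|ᾱ₀| + |ᾱ₁| ≤ M` and `ᾱ₀ • x̄₀ + ᾱ₁ • x̄₁ ∈ B`, the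
point `x̄₂ = ᾱ₀ • g x̄₀ + ᾱ₁ • g x̄₁` satisfies
`‖f x̄₂‖ ≤ κ ‖ᾱ₀ • f x̄₀ + ᾱ₁ • f x̄₁‖ + C (‖f x̄₀‖² + ‖f x̄₁‖²)`, where `f x = g x - x`. -/
theorem AA1_inner_step_residual_bound
    (κ L M : ℝ) (hκ0 : 0 < κ) (hκ1 : κ < 1) (hL : 0 ≤ L) (hM : 1 ≤ M) :
    ∃ C > 0, ∀ (n : ℕ)
      (g : EuclideanSpace ℝ (Fin n) → EuclideanSpace ℝ (Fin n))
      (g' : EuclideanSpace ℝ (Fin n) →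
        (EuclideanSpace ℝ (Fin n) →L[ℝ] EuclideanSpace ℝ (Fin n)))
      (xstar : EuclideanSpace ℝ (Fin n)) (ρ : ℝ),
      g xstar = xstar →
      (∀ x y, ‖g y - g x‖ ≤ κ * ‖y - x‖) →
      (∀ x ∈ Metric.closedBall xstar ρ, HasFDerivAt g (g' x) x) →
      (∀ x ∈ Metric.closedBall xstar ρ, ∀ y ∈ Metric.closedBall xstar ρ,
        ‖g' x - g' y‖ ≤ L * ‖x - y‖) →
      ∀ xb0 ∈ Metric.closedBall xstar ρ,
        g xb0 ∈ Metric.closedBall xstar ρ →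
        ∀ a₀ a₁ : ℝ, a₀ + a₁ = 1 → |a₀| + |a₁| ≤ M →
          a₀ • xb0 + a₁ • g xb0 ∈ Metric.closedBall xstar ρ →
          ‖g (a₀ • g xb0 + a₁ • g (g xb0)) - (a₀ • g xb0 + a₁ • g (g xb0))‖ ≤
            κ * ‖a₀ • (g xb0 - xb0) + a₁ • (g (g xb0) - g xb0)‖ +
            C * (‖g xb0 - xb0‖ ^ 2 + ‖g (g xb0) - g xb0‖ ^ 2) := by
  refine ⟨L * (M * M * M) + 1, by positivity, ?_⟩
  intro n g g' xstar ρ _ hcontr hg hLip x hx hgx a b hab habM hz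
  have hquad := (convex_closedBall xstar ρ).norm_map_affine_combination_sub_le
    hL hg hLip hx hgx hab hz
  have hcoef : |a| * |b| * (|a| + |b|) ≤ M * M * M := by
    have ha : |a| ≤ M := by linarith [abs_nonneg b]
    have hb : |b| ≤ M := by linarith [abs_nonneg a]
    gcongr
  have hlin := hcontr (a • x + b • g x) (a • g x + b • g (g x))
  have hdiff : a • g x + b • g (g x) - (a • x + b • g x) =
      a • (g x - x) + b • (g (g x) - g x) := by module
  rw [hdiff] at hlin
  have hconst : L * (|a| * |b| * (|a| + |b|)) * ‖g x - x‖ ^ 2 ≤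
      (L * (M * M * M) + 1) * (‖g x - x‖ ^ 2 + ‖g (g x) - g x‖ ^ 2) := by
    gcongr
    · nlinarith [mul_le_mul_of_nonneg_left hcoef hL]
    · exact le_add_of_nonneg_right (by positivity)
  calc _ ≤ ‖g (a • g x + b • g (g x)) - g (a • x + b • g x)‖ +
        ‖g (a • x + b • g x) - (a • g x + b • g (g x))‖ := norm_sub_le_norm_sub_add_norm_sub _ _ _
    _ ≤ _ := add_le_add hlin (hquad.trans hconst)
end

section
/- (Second-order linearization error of an affine combination under g.) Let B ⊆ ℝ^n be a closed ball, and let g : ℝ^n → ℝ^n be Fréchet differentiable at every point of B with the derivative map x ↦ g′(x) being L-Lipschitz on B. Let x_0, …, x_m ∈ B and let α_0, …, α_m ∈ ℝ satisfy Σ_{i=0}^m α_i = 1, and suppose x^α := Σ_{i=0}^m α_i x_i ∈ B. Then ‖Σ_{i=0}^m α_i g(x_i) − g(x^α)‖ ≤ (L/2) Σ_{i=0}^m |α_i| ‖x_i − x^α‖². -/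
/-- First-order Taylor estimate on a convex set: if the derivative `f'` of `f` satisfies a Lipschitz
bound with constant `L` based at `a`, the linearization error of `f` at `a` is at most
`L / 2 * ‖y - a‖ ^ 2`. -/
theorem Convex.norm_image_sub_sub_le_of_norm_fderiv_sub_le
    {E F : Type*} [NormedAddCommGroup E] [NormedSpace ℝ E]
    [NormedAddCommGroup F] [NormedSpace ℝ F] {f : E → F} {f' : E → E →L[ℝ] F} {s : Set E}
    {L : ℝ} {a y : E} (hs : Convex ℝ s) (hf : ∀ x ∈ s, HasFDerivAt f (f' x) x)
    (hL : ∀ x ∈ s, ‖f' x - f' a‖ ≤ L * ‖x - a‖) (ha : a ∈ s) (hy : y ∈ s) :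
    ‖f y - f a - f' a (y - a)‖ ≤ L / 2 * ‖y - a‖ ^ 2 := by
  set v := y - a with hv
  have hmem : ∀ t ∈ Set.Icc (0 : ℝ) 1, a + t • v ∈ s := fun t ht =>
    hs.add_smul_sub_mem ha hy ht
  have hφ : ∀ t ∈ Set.Icc (0 : ℝ) 1,
      HasDerivAt (fun t : ℝ => f (a + t • v) - f a - t • f' a v)
        ((f' (a + t • v) - f' a) v) t := by
    intro t ht
    have hline : HasDerivAt (fun t : ℝ => a + t • v) v t := by
      simpa using ((hasDerivAt_id t).smul_const v).const_add a
    have hlin : HasDerivAt (fun t : ℝ => t • f' a v) (f' a v) t := by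
      simpa using (hasDerivAt_id t).smul_const (f' a v)
    exact (((hf _ (hmem t ht)).comp_hasDerivAt t hline).sub_const (f a)).sub hlin
  have hB : ∀ t : ℝ, HasDerivAt (fun t : ℝ => L / 2 * ‖v‖ ^ 2 * t ^ 2) (L * ‖v‖ ^ 2 * t) t := by
    intro t
    refine ((hasDerivAt_pow 2 t).const_mul (L / 2 * ‖v‖ ^ 2)).congr_deriv ?_
    norm_num
    ring
  have key := image_norm_le_of_norm_deriv_right_le_deriv_boundary
    (fun t ht => (hφ t ht).continuousAt.continuousWithinAt)
    (fun t ht => (hφ t (Set.Ico_subset_Icc_self ht)).hasDerivWithinAt)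
    (by simp) hB
    (fun t ht => by
      have hbound := hL _ (hmem t (Set.Ico_subset_Icc_self ht))
      rw [add_sub_cancel_left, norm_smul, Real.norm_of_nonneg ht.1] at hbound
      calc ‖(f' (a + t • v) - f' a) v‖ ≤ L * (t * ‖v‖) * ‖v‖ :=
            ContinuousLinearMap.le_of_opNorm_le _ hbound v
        _ = L * ‖v‖ ^ 2 * t := by ring)
    (Set.right_mem_Icc.2 zero_le_one)
  simpa [hv] using key


/-- Second-order linearization error of an affine combination under `g`.
If `g` is Fréchet differentiable on a closed ball `B` with `L`-Lipschitz derivative,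
`x 0, …, x m ∈ B`, `∑ α i = 1`, and `x^α = ∑ α i • x i ∈ B`, then
`‖∑ α i • g (x i) - g x^α‖ ≤ (L/2) ∑ |α i| ‖x i - x^α‖²`. -/
theorem affine_combination_linearization_error
    (n : ℕ) (c : EuclideanSpace ℝ (Fin n)) (ρ : ℝ) (L : ℝ)
    (g : EuclideanSpace ℝ (Fin n) → EuclideanSpace ℝ (Fin n))
    (g' : EuclideanSpace ℝ (Fin n) →
      (EuclideanSpace ℝ (Fin n) →L[ℝ] EuclideanSpace ℝ (Fin n)))
    (hderiv : ∀ x ∈ Metric.closedBall c ρ, HasFDerivAt g (g' x) x)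
    (hlip : ∀ x ∈ Metric.closedBall c ρ, ∀ y ∈ Metric.closedBall c ρ,
      ‖g' x - g' y‖ ≤ L * ‖x - y‖)
    (m : ℕ) (x : Fin (m + 1) → EuclideanSpace ℝ (Fin n)) (α : Fin (m + 1) → ℝ)
    (hx : ∀ i, x i ∈ Metric.closedBall c ρ)
    (hsum : (∑ i, α i) = 1)
    (hxa : (∑ i, α i • x i) ∈ Metric.closedBall c ρ) :
    ‖(∑ i, α i • g (x i)) - g (∑ i, α i • x i)‖ ≤
      (L / 2) * ∑ i, |α i| * ‖x i - (∑ j, α j • x j)‖ ^ 2 := by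
  set a := ∑ i, α i • x i with ha
  have hfirst : ∑ i, α i • g' a (x i - a) = 0 := by
    simp_rw [← map_smul, ← map_sum, smul_sub, Finset.sum_sub_distrib, ← Finset.sum_smul, hsum,
      one_smul, ← ha, sub_self, map_zero]
  have hrem : (∑ i, α i • g (x i)) - g a = ∑ i, α i • (g (x i) - g a - g' a (x i - a)) := by
    simp_rw [smul_sub (α _), Finset.sum_sub_distrib, hfirst, ← Finset.sum_smul, hsum, one_smul,
      sub_zero]
  rw [hrem, Finset.mul_sum]
  refine norm_sum_le_of_le _ fun i _ => ?_
  rw [norm_smul, Real.norm_eq_abs, mul_left_comm]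
  exact mul_le_mul_of_nonneg_left
    ((convex_closedBall c ρ).norm_image_sub_sub_le_of_norm_fderiv_sub_le hderiv
      (fun y hy => hlip y hy a hxa) hxa (hx i)) (abs_nonneg _)
end
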